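/- Let R be a commutative ring and k ≥ 1. Let A, B : ℤ → ℤ → R be pseudo-difference operator coefficient families with A_i = 0 for i > k and B_i = 0 for i < −k, satisfying the adjoint relation A*∘(Λ−Λ⁻¹) = (Λ−Λ⁻¹)∘B (coefficientwise). Then for every n ∈ ℤ, A_0(n) + B_0(n) = h(n+1) + h(n), where h(n) := ∑_{i=0}^{k} A_i(n) − ∑_{i=−k}^{−1} B_i(n); equivalently A_{[0]} + B_{[0]} = (Λ+1)( (A_{≥0} − B_{≤−1})|_{Λ=1} ). -/

import Mathlib

/-!
Pseudo-difference operators over a commutative ring `R` are encoded by coefficient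
families `C : ℤ → ℤ → R`, where `C i n` is the coefficient of `Λ^i` at site `n` in
`C = ∑_{i∈ℤ} C_i(n) Λ^i`, `Λ` being the shift operator `(Λ f)(n) = f (n+1)`.
-/

namespace BKP

variable {R : Type*} [CommRing R]

/-- Composition of pseudo-difference operators:
`(C∘D)_p(n) = ∑_{i+j=p} C_i(n) · D_j(n+i)` (a `finsum`, well defined when finitely
many terms are nonzero). -/
noncomputable def comp (C D : ℤ → ℤ → R) : ℤ → ℤ → R :=
  fun p n => ∑ᶠ i : ℤ, C i n * D (p - i) (n + i)

/-- Formal adjoint: `(C*)_i(n) = C_{−i}(n+i)`. -/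
def adj (C : ℤ → ℤ → R) : ℤ → ℤ → R := fun i n => C (-i) (n + i)

/-- The operator `Λ^m`: coefficient `1` at `i = m`, `0` elsewhere.  `shift 0` is the
identity operator. -/
def shift (m : ℤ) : ℤ → ℤ → R := fun i _ => if i = m then (1 : R) else 0

/-- The operator `Λ − Λ⁻¹`: coefficient `1` at `i = 1` and `−1` at `i = −1`. -/
def lam : ℤ → ℤ → R := fun i _ => if i = 1 then (1 : R) else if i = -1 then -1 else 0

/-- Truncation `C_{≥m}`. -/
def truncGe (m : ℤ) (C : ℤ → ℤ → R) : ℤ → ℤ → R := fun i n => if m ≤ i then C i n else 0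

/-- Truncation `C_{≤m}`. -/
def truncLe (m : ℤ) (C : ℤ → ℤ → R) : ℤ → ℤ → R := fun i n => if i ≤ m then C i n else 0

/-- Truncation `C_{<m}`. -/
def truncLt (m : ℤ) (C : ℤ → ℤ → R) : ℤ → ℤ → R := fun i n => if i < m then C i n else 0

/-- Power of a pseudo-difference operator. -/
noncomputable def powOp (C : ℤ → ℤ → R) : ℕ → ℤ → ℤ → R
  | 0 => shift 0
  | m + 1 => comp C (powOp C m)

end BKP

theorem comp_lam_right {R : Type*} [CommRing R] (C : ℤ → ℤ → R) (p n : ℤ) :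
    BKP.comp C BKP.lam p n = C (p - 1) n - C (p + 1) n := by
  unfold BKP.comp BKP.lam
  rw [finsum_eq_sum_of_support_subset (s := {p - 1, p + 1})]
  · rw [Finset.sum_pair (by omega)]
    have h1 : p - (p - 1) = 1 := by ring
    have h2 : p - (p + 1) = -1 := by ring
    simp [h1, h2, sub_eq_add_neg]
  · intro i hi
    by_contra hc
    simp only [Finset.coe_insert, Finset.coe_singleton, Set.mem_insert_iff,
      Set.mem_singleton_iff, not_or] at hc
    apply hi
    have h1 : ¬ (p - i = 1) := by omega
    have h2 : ¬ (p - i = -1) := by omega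
    simp [h1, h2]

theorem comp_lam_left {R : Type*} [CommRing R] (C : ℤ → ℤ → R) (p n : ℤ) :
    BKP.comp BKP.lam C p n = C (p - 1) (n + 1) - C (p + 1) (n - 1) := by
  unfold BKP.comp BKP.lam
  rw [finsum_eq_sum_of_support_subset (s := {1, -1})]
  · rw [Finset.sum_pair (by omega)]
    simp [sub_eq_add_neg]
  · intro i hi
    by_contra hc
    simp only [Finset.coe_insert, Finset.coe_singleton, Set.mem_insert_iff,
      Set.mem_singleton_iff, not_or] at hc
    apply hi
    simp [hc.1, hc.2]

theorem rel_aux {R : Type*} [CommRing R] (A B : ℤ → ℤ → R)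
    (hadj : BKP.comp (BKP.adj A) BKP.lam = BKP.comp BKP.lam B) (q m : ℤ) :
    A (q + 1) (m - 1) - B (-(q + 1)) (m + q + 1)
      = A (q - 1) (m + 1) - B (-(q - 1)) (m + q - 1) := by
  have h := congrFun (congrFun hadj (-q)) (m + q)
  rw [comp_lam_right, comp_lam_left] at h
  unfold BKP.adj at h
  have e1 : -(-q - 1) = q + 1 := by ring
  have e2 : m + q + (-q - 1) = m - 1 := by ring
  have e3 : -(-q + 1) = q - 1 := by ring
  have e4 : m + q + (-q + 1) = m + 1 := by ring
  have e5 : -q - 1 = -(q + 1) := by ring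
  have e6 : -q + 1 = -(q - 1) := by ring
  rw [e1, e2, e3, e4, e5, e6] at h
  linear_combination h

/-- Auxiliary sums. -/
def wAux {R : Type*} [CommRing R] (A B : ℤ → ℤ → R) (n : ℤ) (r : ℕ) : R :=
  ∑ b ∈ Finset.range r, (A (r + 1) (n - 1 - b) - B (-(r + 1)) (n + r + 1 - b))

theorem wAux_rec {R : Type*} [CommRing R] (A B : ℤ → ℤ → R)
    (hadj : BKP.comp (BKP.adj A) BKP.lam = BKP.comp BKP.lam B) (n : ℤ) (r : ℕ) :
    wAux A B n (r + 2) = wAux A B n r + (A (r + 1) n - B (-(r + 1)) n)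
      + (A (r + 1) (n + 1) - B (-(r + 1)) (n + 1)) := by
  have h : wAux A B n (r + 2) = ∑ b ∈ Finset.range (r + 2),
      (A (r + 1) (n + 1 - b) - B (-(r + 1)) (n + r + 1 - b)) := by
    unfold wAux
    refine Finset.sum_congr rfl fun b _ => ?_
    have := rel_aux A B hadj (r + 2) (n - b)
    push_cast
    convert this using 3 <;> ring
  rw [h, Finset.sum_sub_distrib, Finset.sum_range_succ', Finset.sum_range_succ',
    Finset.sum_range_succ, Finset.sum_range_succ]
  unfold wAux
  rw [Finset.sum_sub_distrib]
  have e : ∀ b : ℕ, n + 1 - ((b + 1 + 1 : ℕ) : ℤ) = n - 1 - b := by intro b; push_cast; ring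
  have e1 : n + 1 - ((0 + 1 : ℕ) : ℤ) = n := by push_cast; ring
  have e2 : n + 1 - ((0 : ℕ) : ℤ) = n + 1 := by push_cast; ring
  have e3 : n + r + 1 - ((r + 1 : ℕ) : ℤ) = n := by push_cast; ring
  have e4 : n + r + 1 - (r : ℤ) = n + 1 := by ring
  simp only [e, e1, e2, e3, e4]
  ring

theorem wAux_sum {R : Type*} [CommRing R] (A B : ℤ → ℤ → R)
    (hadj : BKP.comp (BKP.adj A) BKP.lam = BKP.comp BKP.lam B) (n : ℤ) (N : ℕ) :
    wAux A B n N + wAux A B n (N + 1) = A 0 (n + 1) - B 0 n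
      + ∑ r ∈ Finset.range N, ((A (r + 1) n - B (-(r + 1)) n)
      + (A (r + 1) (n + 1) - B (-(r + 1)) (n + 1))) := by
  induction N with
  | zero =>
    have := rel_aux A B hadj 1 n
    simp [wAux] at this ⊢
    convert this using 3
  | succ N ih =>
    rw [Finset.sum_range_succ, ← add_assoc, ← ih, wAux_rec A B hadj]
    ring

/-- If `A` is supported in powers `≤ k`, `B` in powers `≥ −k` (`k ≥ 1`), and the
adjoint relation `A*∘(Λ−Λ⁻¹) = (Λ−Λ⁻¹)∘B` holds, then
`A_{[0]} + B_{[0]} = (Λ+1)((A_{≥0} − B_{≤−1})|_{Λ=1})`, i.e. for all `n`,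
`A_0(n) + B_0(n) = h(n+1) + h(n)` with
`h(n) = ∑_{i=0}^{k} A_i(n) − ∑_{i=−k}^{−1} B_i(n)`. -/
theorem stmt5 {R : Type*} [CommRing R] (k : ℤ) (hk : 1 ≤ k) (A B : ℤ → ℤ → R)
    (hA : ∀ i : ℤ, k < i → ∀ n : ℤ, A i n = 0)
    (hB : ∀ i : ℤ, i < -k → ∀ n : ℤ, B i n = 0)
    (hadj : BKP.comp (BKP.adj A) BKP.lam = BKP.comp BKP.lam B)
    (h : ℤ → R)
    (hh : ∀ n : ℤ,
      h n = (∑ i ∈ Finset.Icc (0 : ℤ) k, A i n) - ∑ i ∈ Finset.Icc (-k) (-1 : ℤ), B i n) :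
    ∀ n : ℤ, A 0 n + B 0 n = h (n + 1) + h n := by
  intro n
  obtain ⟨K, rfl⟩ := Int.eq_ofNat_of_zero_le (show 0 ≤ k by omega)
  have hw : ∀ r : ℕ, K ≤ r → wAux A B n r = 0 := by
    intro r hr
    unfold wAux
    refine Finset.sum_eq_zero fun b _ => ?_
    rw [hA _ (by omega), hB _ (by omega), sub_zero]
  have key := wAux_sum A B hadj n K
  rw [hw K le_rfl, hw (K + 1) (by omega)] at key
  have sA : ∀ m, ∑ i ∈ Finset.Icc (0 : ℤ) K, A i m
      = A 0 m + ∑ r ∈ Finset.range K, A (r + 1) m := by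
    intro m
    have : ∑ i ∈ Finset.Icc (0 : ℤ) K, A i m = ∑ r ∈ Finset.range (K + 1), A r m := by
      symm
      refine Finset.sum_nbij' (fun r : ℕ => (r : ℤ)) Int.toNat ?_ ?_ ?_ ?_ ?_
      · intro a ha; simp at ha ⊢; omega
      · intro a ha; simp at ha ⊢; omega
      · intro a ha; simp
      · intro a ha; simp at ha ⊢; omega
      · intro a ha; rfl
    rw [this, Finset.sum_range_succ']
    push_cast
    ring
  have sB : ∀ m, ∑ i ∈ Finset.Icc (-(K : ℤ)) (-1 : ℤ), B i m
      = ∑ r ∈ Finset.range K, B (-(r + 1)) m := by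
    intro m
    symm
    refine Finset.sum_nbij' (fun r : ℕ => -((r : ℤ) + 1)) (fun i => (-i - 1).toNat) ?_ ?_ ?_ ?_ ?_
    · intro a ha; simp at ha ⊢; omega
    · intro a ha; simp at ha ⊢; omega
    · intro a ha; simp
    · intro a ha; simp at ha ⊢; omega
    · intro a ha; rfl
  have hh' : ∀ m, h m = (A 0 m + ∑ r ∈ Finset.range K, A (r + 1) m)
      - ∑ r ∈ Finset.range K, B (-(r + 1)) m := by
    intro m
    rw [← sA, ← sB]
    exact hh m
  rw [hh', hh']
  simp only [Finset.sum_add_distrib, Finset.sum_sub_distrib] at key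
  linear_combination key
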